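/- arXiv:2507.21752 — 4 statements merged into one kernel-verified Lean document; each statement's English description precedes it below -/
import Mathlib

section
/- Let O ⊆ {¬,⊓,⊔,∀,∃}, let P, N be sets of examples and k ∈ ℕ, and let Σ be the set of concept and role names occurring in the examples of P and N. If there is an L(O) concept of size at most k that fits P, N, then there is an L(O) concept of size at most k that fits P, N and whose signature is contained in Σ. -/
open scoped ENNReal

namespace ALCPaper

/-- ALC concepts; concept names and role names are natural numbers. -/
inductive ALC : Type
  | bot
  | top
  | atom (A : ℕ)
  | neg (c : ALC)
  | inter (c d : ALC)
  | union (c d : ALC)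
  | all (r : ℕ) (c : ALC)
  | ex (r : ℕ) (c : ALC)
  deriving DecidableEq

/-- An interpretation: a domain of natural numbers, extensions of concept names,
and extensions of role names. -/
structure Interp where
  dom : Set ℕ
  cI : ℕ → Set ℕ
  rI : ℕ → Set (ℕ × ℕ)

/-- Well-formedness of an interpretation: the domain is nonempty, concept name
extensions are subsets of the domain and role name extensions are binary relations
on the domain. -/
def Interp.WF (I : Interp) : Prop :=
  I.dom.Nonempty ∧ (∀ A, I.cI A ⊆ I.dom) ∧
    ∀ r, ∀ p ∈ I.rI r, p.1 ∈ I.dom ∧ p.2 ∈ I.dom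

/-- The extension `C^I` of a concept `C` in an interpretation `I`. -/
def ALC.sem : ALC → Interp → Set ℕ
  | .bot, _ => ∅
  | .top, I => I.dom
  | .atom A, I => I.cI A
  | .neg c, I => I.dom \ c.sem I
  | .inter c d, I => c.sem I ∩ d.sem I
  | .union c d, I => c.sem I ∪ d.sem I
  | .all r c, I => {d | d ∈ I.dom ∧ ∀ e, (d, e) ∈ I.rI r → e ∈ c.sem I}
  | .ex r c, I => {d | ∃ e, (d, e) ∈ I.rI r ∧ e ∈ c.sem I}

/-- The size of a concept: the number of nodes of its syntax tree. -/
def ALC.size : ALC → ℕ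
  | .bot => 1
  | .top => 1
  | .atom _ => 1
  | .neg c => c.size + 1
  | .inter c d => c.size + d.size + 1
  | .union c d => c.size + d.size + 1
  | .all _ c => c.size + 1
  | .ex _ c => c.size + 1

/-- The quantifier depth of a concept: the nesting depth of ∃/∀. -/
def ALC.qdepth : ALC → ℕ
  | .bot => 0
  | .top => 0
  | .atom _ => 0
  | .neg c => c.qdepth
  | .inter c d => max c.qdepth d.qdepth
  | .union c d => max c.qdepth d.qdepth
  | .all _ c => c.qdepth + 1
  | .ex _ c => c.qdepth + 1

/-- The concept names occurring in a concept. -/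
def ALC.conceptNames : ALC → Finset ℕ
  | .bot => ∅
  | .top => ∅
  | .atom A => {A}
  | .neg c => c.conceptNames
  | .inter c d => c.conceptNames ∪ d.conceptNames
  | .union c d => c.conceptNames ∪ d.conceptNames
  | .all _ c => c.conceptNames
  | .ex _ c => c.conceptNames

/-- The role names occurring in a concept. -/
def ALC.roleNames : ALC → Finset ℕ
  | .bot => ∅
  | .top => ∅
  | .atom _ => ∅
  | .neg c => c.roleNames
  | .inter c d => c.roleNames ∪ d.roleNames
  | .union c d => c.roleNames ∪ d.roleNames
  | .all r c => insert r c.roleNames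
  | .ex r c => insert r c.roleNames

/-- The five constructors ¬, ⊓, ⊔, ∀, ∃. -/
inductive Op : Type
  | neg | inter | union | all | ex
  deriving DecidableEq

/-- Membership in the fragment L(O): the concept is built from ⊤, ⊥ and concept
names using only constructors from O. -/
def ALC.InLang (O : Set Op) : ALC → Prop
  | .bot => True
  | .top => True
  | .atom _ => True
  | .neg c => Op.neg ∈ O ∧ c.InLang O
  | .inter c d => Op.inter ∈ O ∧ c.InLang O ∧ d.InLang O
  | .union c d => Op.union ∈ O ∧ c.InLang O ∧ d.InLang O
  | .all _ c => Op.all ∈ O ∧ c.InLang O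
  | .ex _ c => Op.ex ∈ O ∧ c.InLang O

/-- The dual of a constructor. -/
def Op.dual : Op → Op
  | .neg => .neg
  | .inter => .union
  | .union => .inter
  | .all => .ex
  | .ex => .all

/-- The dual concept C̄. -/
def ALC.dual : ALC → ALC
  | .bot => .top
  | .top => .bot
  | .atom A => .atom A
  | .neg c => .neg c.dual
  | .inter c d => .union c.dual d.dual
  | .union c d => .inter c.dual d.dual
  | .all r c => .ex r c.dual
  | .ex r c => .all r c.dual

open Classical in
/-- The interpretation Ī_Σ obtained by complementing the extensions of the concept
names in Σ (here `S` is the set of concept names of the signature Σ). -/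
noncomputable def Interp.dualWrt (I : Interp) (S : Set ℕ) : Interp where
  dom := I.dom
  cI := fun A => if A ∈ S then I.dom \ I.cI A else I.cI A
  rI := I.rI

/-- A pointed interpretation. -/
abbrev Ex : Type := Interp × ℕ

/-- A finite interpretation: finite domain and only finitely many concept and role
names with nonempty extension. -/
def Interp.FiniteI (I : Interp) : Prop :=
  I.dom.Finite ∧ {A | (I.cI A).Nonempty}.Finite ∧ {r | (I.rI r).Nonempty}.Finite

/-- An example: a finite (well-formed) interpretation with a distinguished domain
element. -/
def IsExample (e : Ex) : Prop := e.1.WF ∧ e.1.FiniteI ∧ e.2 ∈ e.1.dom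

/-- The dual example (Ī_Σ, a). -/
noncomputable def dualEx (S : Set ℕ) (e : Ex) : Ex := (e.1.dualWrt S, e.2)

/-- `C` fits the positive examples `P` and the negative examples `N`. -/
def Fits (C : ALC) (P N : Set Ex) : Prop :=
  (∀ e ∈ P, e.2 ∈ C.sem e.1) ∧ ∀ e ∈ N, e.2 ∉ C.sem e.1

/-- Subsumption C ⊑ D: `C^I ⊆ D^I` for every interpretation `I`. -/
def Subsume (C D : ALC) : Prop := ∀ I : Interp, I.WF → C.sem I ⊆ D.sem I

/-- Equivalence of concepts. -/
def CEquiv (C D : ALC) : Prop := Subsume C D ∧ Subsume D C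

/-- The concept names occurring in (the facts of) a set of examples. -/
def exCNames (E : Set Ex) : Set ℕ := {A | ∃ e ∈ E, (e.1.cI A).Nonempty}

/-- The role names occurring in (the facts of) a set of examples. -/
def exRNames (E : Set Ex) : Set ℕ := {r | ∃ e ∈ E, (e.1.rI r).Nonempty}

theorem exists_restrict (O : Set Op) (E : Set Ex) (C : ALC) (hC : C.InLang O) :
    ∃ D : ALC, D.InLang O ∧ D.size ≤ C.size ∧ (∀ e ∈ E, D.sem e.1 = C.sem e.1) ∧
      (∀ A ∈ D.conceptNames, A ∈ exCNames E) ∧ (∀ r ∈ D.roleNames, r ∈ exRNames E) := by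
  induction C with
  | bot => exact ⟨.bot, hC, le_rfl, fun _ _ => rfl, by simp [ALC.conceptNames],
      by simp [ALC.roleNames]⟩
  | top => exact ⟨.top, hC, le_rfl, fun _ _ => rfl, by simp [ALC.conceptNames],
      by simp [ALC.roleNames]⟩
  | atom A =>
    by_cases hA : A ∈ exCNames E
    · exact ⟨.atom A, hC, le_rfl, fun _ _ => rfl, by simpa [ALC.conceptNames] using hA,
        by simp [ALC.roleNames]⟩
    · refine ⟨.bot, trivial, le_rfl, fun e he => ?_, by simp [ALC.conceptNames],
        by simp [ALC.roleNames]⟩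
      by_contra hne
      exact hA ⟨e, he, Set.nonempty_iff_ne_empty.2 (fun h => hne h.symm)⟩
  | neg c ih =>
    obtain ⟨D, h1, h2, h3, h4, h5⟩ := ih hC.2
    refine ⟨.neg D, ⟨hC.1, h1⟩, by simp only [ALC.size]; omega, fun e he => ?_, h4, h5⟩
    simp only [ALC.sem, h3 e he]
  | inter c d ih1 ih2 =>
    obtain ⟨D, h1, h2, h3, h4, h5⟩ := ih1 hC.2.1
    obtain ⟨D', h1', h2', h3', h4', h5'⟩ := ih2 hC.2.2
    refine ⟨.inter D D', ⟨hC.1, h1, h1'⟩, by simp only [ALC.size]; omega, fun e he => ?_,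
      fun A hA => (Finset.mem_union.1 hA).elim (h4 A) (h4' A),
      fun A hA => (Finset.mem_union.1 hA).elim (h5 A) (h5' A)⟩
    simp only [ALC.sem, h3 e he, h3' e he]
  | union c d ih1 ih2 =>
    obtain ⟨D, h1, h2, h3, h4, h5⟩ := ih1 hC.2.1
    obtain ⟨D', h1', h2', h3', h4', h5'⟩ := ih2 hC.2.2
    refine ⟨.union D D', ⟨hC.1, h1, h1'⟩, by simp only [ALC.size]; omega, fun e he => ?_,
      fun A hA => (Finset.mem_union.1 hA).elim (h4 A) (h4' A),
      fun A hA => (Finset.mem_union.1 hA).elim (h5 A) (h5' A)⟩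
    simp only [ALC.sem, h3 e he, h3' e he]
  | all r c ih =>
    obtain ⟨D, h1, h2, h3, h4, h5⟩ := ih hC.2
    by_cases hr : r ∈ exRNames E
    · refine ⟨.all r D, ⟨hC.1, h1⟩, by simp only [ALC.size]; omega, fun e he => ?_, h4,
        fun x hx => (Finset.mem_insert.1 hx).elim (fun h => h ▸ hr) (h5 x)⟩
      simp only [ALC.sem, h3 e he]
    · refine ⟨.top, trivial, by simp only [ALC.size]; omega, fun e he => ?_,
        by simp [ALC.conceptNames], by simp [ALC.roleNames]⟩
      ext x
      exact ⟨fun hx => ⟨hx, fun y hy => (hr ⟨e, he, _, hy⟩).elim⟩, fun hx => hx.1⟩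
  | ex r c ih =>
    obtain ⟨D, h1, h2, h3, h4, h5⟩ := ih hC.2
    by_cases hr : r ∈ exRNames E
    · refine ⟨.ex r D, ⟨hC.1, h1⟩, by simp only [ALC.size]; omega, fun e he => ?_, h4,
        fun x hx => (Finset.mem_insert.1 hx).elim (fun h => h ▸ hr) (h5 x)⟩
      simp only [ALC.sem, h3 e he]
    · refine ⟨.bot, trivial, by simp only [ALC.size]; omega, fun e he => ?_,
        by simp [ALC.conceptNames], by simp [ALC.roleNames]⟩
      ext x
      exact ⟨fun hx => hx.elim, fun ⟨y, hy, _⟩ => (hr ⟨e, he, _, hy⟩).elim⟩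

/-- If there is an L(O) concept of size at most k that fits P, N, then
there is an L(O) concept of size at most k that fits P, N and whose signature is
contained in the signature Σ of the examples of P and N. -/
theorem statement2 (O : Set Op) (P N : Set Ex) (k : ℕ)
    (hPfin : P.Finite) (hNfin : N.Finite) (hex : ∀ e ∈ P ∪ N, IsExample e)
    (h : ∃ C : ALC, C.InLang O ∧ C.size ≤ k ∧ Fits C P N) :
    ∃ C : ALC, C.InLang O ∧ C.size ≤ k ∧ Fits C P N ∧
      (C.conceptNames : Set ℕ) ⊆ exCNames (P ∪ N) ∧
      (C.roleNames : Set ℕ) ⊆ exRNames (P ∪ N) := by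
  obtain ⟨C, hC, hk, hP, hN⟩ := h
  obtain ⟨D, h1, h2, h3, h4, h5⟩ := exists_restrict O (P ∪ N) C hC
  refine ⟨D, h1, h2.trans hk, ⟨fun e he => ?_, fun e he => ?_⟩, fun A hA => h4 A hA,
    fun r hr => h5 r hr⟩
  · rw [h3 e (Or.inl he)]; exact hP e he
  · rw [h3 e (Or.inr he)]; exact hN e he

end ALCPaper
end

section
/- Let O ⊆ {¬,⊓,⊔,∀,∃}, let P, N be sets of examples and k ∈ ℕ, and let Σ be the set of concept and role names occurring in the examples of P and N. There is an L(O) concept of size at most k that fits P, N if and only if there is an L(Ō) concept of size at most k that fits N̄_Σ, P̄_Σ. -/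
open scoped ENNReal

namespace ALCPaper

open Classical in
/-- Dual of a concept, where names outside `S` are replaced by top. -/
noncomputable def trS (S : Set ℕ) : ALC → ALC
  | .bot => .top
  | .top => .bot
  | .atom A => if A ∈ S then .atom A else .top
  | .neg c => .neg (trS S c)
  | .inter c d => .union (trS S c) (trS S d)
  | .union c d => .inter (trS S c) (trS S d)
  | .all r c => .ex r (trS S c)
  | .ex r c => .all r (trS S c)

theorem trS_size (S : Set ℕ) (C : ALC) : (trS S C).size = C.size := by
  induction C with
  | atom A => by_cases h : A ∈ S <;> simp [trS, ALC.size, h]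
  | _ => simp_all [trS, ALC.size]

theorem trS_lang (S : Set ℕ) (O O' : Set Op) (hO : ∀ o ∈ O, Op.dual o ∈ O') (C : ALC)
    (hC : C.InLang O) : (trS S C).InLang O' := by
  induction C with
  | atom A => by_cases h : A ∈ S <;> simp [trS, ALC.InLang, h]
  | bot => trivial
  | top => trivial
  | neg c ih => exact ⟨hO _ hC.1, ih hC.2⟩
  | inter c d ih1 ih2 => exact ⟨hO _ hC.1, ih1 hC.2.1, ih2 hC.2.2⟩
  | union c d ih1 ih2 => exact ⟨hO _ hC.1, ih1 hC.2.1, ih2 hC.2.2⟩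
  | all r c ih => exact ⟨hO _ hC.1, ih hC.2⟩
  | ex r c ih => exact ⟨hO _ hC.1, ih hC.2⟩

theorem trS_sem (S : Set ℕ) (I J : Interp) (hd : J.dom = I.dom) (hr : J.rI = I.rI)
    (hrw : ∀ r, ∀ p ∈ I.rI r, p.1 ∈ I.dom ∧ p.2 ∈ I.dom)
    (hS : ∀ A ∈ S, ∀ d ∈ I.dom, d ∈ J.cI A ↔ d ∉ I.cI A)
    (hn : ∀ A, A ∉ S → I.cI A = ∅) (C : ALC) :
    ∀ d ∈ I.dom, d ∈ (trS S C).sem J ↔ d ∉ C.sem I := by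
  induction C with
  | atom A =>
    intro d hdd
    by_cases h : A ∈ S
    · simpa [trS, ALC.sem, h] using hS A h d hdd
    · simp [trS, ALC.sem, h, hn A h, hd, hdd]
  | bot => intro d hdd; simp [trS, ALC.sem, hd, hdd]
  | top => intro d hdd; simp [trS, ALC.sem, hdd]
  | neg c ih => intro d hdd; simp [trS, ALC.sem, hd, hdd, ih d hdd]
  | inter c e ih1 ih2 =>
    intro d hdd
    simp only [trS, ALC.sem, Set.mem_union, Set.mem_inter_iff, ih1 d hdd, ih2 d hdd]; tauto
  | union c e ih1 ih2 =>
    intro d hdd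
    simp only [trS, ALC.sem, Set.mem_union, Set.mem_inter_iff, ih1 d hdd, ih2 d hdd]; tauto
  | all r c ih =>
    intro d hdd
    simp only [trS, ALC.sem, Set.mem_ofPred_eq, hr, hdd, true_and]
    push Not
    exact exists_congr fun e => and_congr_right fun h => ih e (hrw r _ h).2
  | ex r c ih =>
    intro d hdd
    simp only [trS, ALC.sem, Set.mem_ofPred_eq, hr, hd, hdd, true_and]
    push Not
    exact forall_congr' fun e => imp_congr_right fun h => ih e (hrw r _ h).2

/-- There is an L(O) concept of size at most k that fits P, N if and
only if there is an L(Ō) concept of size at most k that fits N̄_Σ, P̄_Σ, where Σ is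
the set of concept and role names occurring in the examples of P and N. -/
theorem statement3 (O : Set Op) (P N : Set Ex) (k : ℕ)
    (hPfin : P.Finite) (hNfin : N.Finite) (hex : ∀ e ∈ P ∪ N, IsExample e) :
    (∃ C : ALC, C.InLang O ∧ C.size ≤ k ∧ Fits C P N) ↔
      (∃ C : ALC, C.InLang (Op.dual '' O) ∧ C.size ≤ k ∧
        Fits C (dualEx (exCNames (P ∪ N)) '' N) (dualEx (exCNames (P ∪ N)) '' P)) := by
  have key : ∀ e ∈ P ∪ N, ∀ C : ALC,
      (e.2 ∈ (trS (exCNames (P ∪ N)) C).sem (dualEx (exCNames (P ∪ N)) e).1 ↔ e.2 ∉ C.sem e.1) ∧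
      (e.2 ∈ (trS (exCNames (P ∪ N)) C).sem e.1 ↔
        e.2 ∉ C.sem (dualEx (exCNames (P ∪ N)) e).1) := by
    intro e he C
    obtain ⟨⟨-, -, hrw⟩, -, hm⟩ := hex e he
    have hn : ∀ A, A ∉ exCNames (P ∪ N) → e.1.cI A = ∅ := by
      intro A hA
      by_contra h
      exact hA ⟨e, he, Set.nonempty_iff_ne_empty.2 h⟩
    constructor
    · refine trS_sem _ e.1 (dualEx (exCNames (P ∪ N)) e).1 rfl rfl hrw ?_ hn C e.2 hm
      intro A hA d hd
      simp [dualEx, Interp.dualWrt, hA, hd]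
    · refine trS_sem _ (dualEx (exCNames (P ∪ N)) e).1 e.1 rfl rfl hrw ?_ ?_ C e.2 hm
      · intro A hA d hd
        have hd' : d ∈ e.1.dom := hd
        simp [dualEx, Interp.dualWrt, hA, hd']
      · intro A hA
        simp [dualEx, Interp.dualWrt, hA, hn A hA]
  constructor
  · rintro ⟨C, hL, hs, hP, hN⟩
    refine ⟨trS (exCNames (P ∪ N)) C, trS_lang _ O _ (fun o ho => Set.mem_image_of_mem Op.dual ho) C hL,
      (trS_size _ C).trans_le hs, ?_, ?_⟩
    · rintro _ ⟨e, he, rfl⟩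
      exact (key e (Or.inr he) C).1.2 (hN e he)
    · rintro _ ⟨e, he, rfl⟩ h
      exact (key e (Or.inl he) C).1.1 h (hP e he)
  · rintro ⟨C, hL, hs, hP, hN⟩
    refine ⟨trS (exCNames (P ∪ N)) C, trS_lang _ (Op.dual '' O) _ ?_ C hL,
      (trS_size _ C).trans_le hs, ?_, ?_⟩
    · rintro _ ⟨o, ho, rfl⟩
      cases o <;> exact ho
    · intro e he
      exact (key e (Or.inl he) C).2.2 (hN _ ⟨e, he, rfl⟩)
    · intro e he h
      exact (key e (Or.inr he) C).2.1 h (hP _ ⟨e, he, rfl⟩)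

end ALCPaper
end

section
/- If {S_1,…,S_m} has a hitting set H with |H| ≤ k, then the L({∃}) concept ∃r.C_n fits P = {(I,a)}, N = {(J,b)} and has size at most k' = n + k + 2, where C_0 = A and, for 1 ≤ i ≤ n, C_i = ∃r.C_{i−1} if n − i + 1 ∉ H and C_i = ∃s.∃s.C_{i−1} if n − i + 1 ∈ H. -/
open scoped ENNReal

namespace ALCPaper

/-! Encoding of the domain elements used in the hitting-set reduction.
Tags < 7 together with `Nat.pair` give an injective encoding into ℕ. -/

def el (tag j i : ℕ) : ℕ := tag + 7 * Nat.pair j i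

/-- the root `b` of `J` -/
def eB : ℕ := el 0 0 0
/-- the element `b_{j,i}` -/
def eBB (j i : ℕ) : ℕ := el 1 j i
/-- the element `b'_{j,i}` -/
def eBB' (j i : ℕ) : ℕ := el 2 j i
/-- the sink `c` -/
def eC : ℕ := el 3 0 0
/-- the root `a` of `I` -/
def eA : ℕ := el 4 0 0
/-- the element `a_i` -/
def eAA (i : ℕ) : ℕ := el 5 0 i
/-- the element `a'_i` -/
def eAA' (i : ℕ) : ℕ := el 6 0 i

/-- The r-edges of `J` not involving the root `b`. -/
def JrCore (m n : ℕ) (S : ℕ → Set ℕ) : Set (ℕ × ℕ) :=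
  {p | ∃ j i, 1 ≤ j ∧ j ≤ m ∧ 1 ≤ i ∧ i ≤ n ∧ p = (eBB j (i - 1), eBB j i)} ∪
  {p | ∃ j i, 1 ≤ j ∧ j ≤ m ∧ 1 ≤ i ∧ i ≤ n ∧ i ∉ S j ∧ p = (eBB' j i, eC)} ∪
  {p | ∃ j, 1 ≤ j ∧ j ≤ m ∧ p = (eBB j n, eC)} ∪ {(eC, eC)}

/-- The r-edges of `J`. -/
def JrPairs (m n : ℕ) (S : ℕ → Set ℕ) : Set (ℕ × ℕ) :=
  {p | ∃ j, 1 ≤ j ∧ j ≤ m ∧ p = (eB, eBB j 0)} ∪ JrCore m n S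

/-- The s-edges of `J` (none of them involves the root `b`). -/
def JsPairs (m n : ℕ) (S : ℕ → Set ℕ) : Set (ℕ × ℕ) :=
  {p | ∃ j i, 1 ≤ j ∧ j ≤ m ∧ 1 ≤ i ∧ i ≤ n ∧ i ∉ S j ∧
      (p = (eBB j (i - 1), eBB' j i) ∨ p = (eBB' j i, eBB j i))} ∪
  {p | ∃ j i, 1 ≤ j ∧ j ≤ m ∧ 1 ≤ i ∧ i ≤ n ∧ i ∈ S j ∧ p = (eBB j (i - 1), eC)} ∪
  {p | ∃ j, 1 ≤ j ∧ j ≤ m ∧ p = (eBB j n, eC)} ∪ {(eC, eC)}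

/-- The domain of `J`. -/
def Jdom (m n : ℕ) (S : ℕ → Set ℕ) : Set ℕ :=
  {eB} ∪ {x | ∃ j i, 1 ≤ j ∧ j ≤ m ∧ i ≤ n ∧ x = eBB j i} ∪
  {x | ∃ j i, 1 ≤ j ∧ j ≤ m ∧ 1 ≤ i ∧ i ≤ n ∧ i ∉ S j ∧ x = eBB' j i} ∪ {eC}

/-- The interpretation `J` of the reduction; concept name `A` is 0, role names
`r`, `s` are 0 and 1. -/
def Jinterp (m n : ℕ) (S : ℕ → Set ℕ) : Interp where
  dom := Jdom m n S
  cI := fun A => if A = 0 then {x | ∃ j, 1 ≤ j ∧ j ≤ m ∧ x = eBB j n} else ∅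
  rI := fun ρ => if ρ = 0 then JrPairs m n S else if ρ = 1 then JsPairs m n S else ∅

/-- The domain of `I`: `J` without `b`, extended by `a`, `a_0, …, a_n` and
`a'_1, …, a'_n`. -/
def Idom (m n : ℕ) (S : ℕ → Set ℕ) : Set ℕ :=
  (Jdom m n S \ {eB}) ∪ {eA} ∪ {x | ∃ i, i ≤ n ∧ x = eAA i} ∪
  {x | ∃ i, 1 ≤ i ∧ i ≤ n ∧ x = eAA' i}

/-- The r-edges of `I`. -/
def IrPairs (m n : ℕ) (S : ℕ → Set ℕ) : Set (ℕ × ℕ) :=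
  JrCore m n S ∪ {(eA, eAA 0)} ∪ {p | ∃ j, 1 ≤ j ∧ j ≤ m ∧ p = (eA, eBB j 0)} ∪
  {p | ∃ i, 1 ≤ i ∧ i ≤ n ∧ p = (eAA (i - 1), eAA i)} ∪
  {p | ∃ i, 1 ≤ i ∧ i ≤ n ∧ p = (eAA' i, eC)} ∪ {(eAA n, eC)}

/-- The s-edges of `I`. -/
def IsPairs (m n : ℕ) (S : ℕ → Set ℕ) : Set (ℕ × ℕ) :=
  JsPairs m n S ∪
  {p | ∃ i, 1 ≤ i ∧ i ≤ n ∧ (p = (eAA (i - 1), eAA' i) ∨ p = (eAA' i, eAA i))} ∪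
  {(eAA n, eC)}

/-- The interpretation `I` of the reduction. -/
def Iinterp (m n : ℕ) (S : ℕ → Set ℕ) : Interp where
  dom := Idom m n S
  cI := fun A =>
    if A = 0 then {x | ∃ j, 1 ≤ j ∧ j ≤ m ∧ x = eBB j n} ∪ {eAA n} else ∅
  rI := fun ρ => if ρ = 0 then IrPairs m n S else if ρ = 1 then IsPairs m n S else ∅

/-- The concepts `C_i` built from a hitting set `H`: `C_0 = A` and
`C_i = ∃s.∃s.C_{i-1}` if `n − i + 1 ∈ H`, `C_i = ∃r.C_{i-1}` otherwise. -/
def hsConcept (H : Finset ℕ) (n : ℕ) : ℕ → ALC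
  | 0 => .atom 0
  | i + 1 => if n - i ∈ H then .ex 1 (.ex 1 (hsConcept H n i)) else .ex 0 (hsConcept H n i)

/-- `chainA [t₁, …, t_ℓ]` is the concept `∃t₁.….∃t_ℓ.A`. -/
def chainA : List ℕ → ALC
  | [] => .atom 0
  | t :: ts => .ex t (chainA ts)

theorem el_inj {t t' j j' i i' : ℕ} (ht : t < 7) (ht' : t' < 7) :
    el t j i = el t' j' i' ↔ t = t' ∧ j = j' ∧ i = i' := by
  constructor
  · intro h
    unfold el at h
    have h1 : t = t' := by omega
    have h2 : Nat.pair j i = Nat.pair j' i' := by omega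
    exact ⟨h1, Nat.pair_eq_pair.1 h2⟩
  · rintro ⟨rfl, rfl, rfl⟩; rfl

theorem rsucc {m n : ℕ} {S : ℕ → Set ℕ} {j i e : ℕ} (hi : i < n)
    (h : (eBB j i, e) ∈ JrPairs m n S) : e = eBB j (i + 1) := by
  simp only [JrPairs, JrCore, Set.mem_union, Set.mem_setOf_eq, Prod.mk.injEq, eBB, eBB', eB, eC,
    Set.mem_singleton_iff] at h ⊢
  rcases h with ⟨j', _, _, h, _⟩ | ((⟨j', i', _, _, _, _, h, h'⟩ | ⟨j', i', _, _, _, _, _, h, _⟩) | ⟨j', _, _, h, _⟩) | ⟨h, _⟩ <;>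
    rw [el_inj (by norm_num) (by norm_num)] at h
  · omega
  · obtain ⟨_, rfl, rfl⟩ := h
    rw [h', Nat.sub_add_cancel (by assumption)]
  all_goals omega

theorem ssucc {m n : ℕ} {S : ℕ → Set ℕ} {j i e : ℕ}
    (h : (eBB j i, e) ∈ JsPairs m n S) : (i + 1 ∉ S j ∧ e = eBB' j (i + 1)) ∨ e = eC := by
  simp only [JsPairs, Set.mem_union, Set.mem_setOf_eq, Prod.mk.injEq, eBB, eBB', eB, eC,
    Set.mem_singleton_iff] at h ⊢
  rcases h with ((⟨j', i', _, _, _, _, hs, ⟨h, h'⟩ | ⟨h, h'⟩⟩ | ⟨j', i', _, _, _, _, _, _, h'⟩) | ⟨j', _, _, _, h'⟩) | ⟨_, h'⟩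
  · rw [el_inj (by norm_num) (by norm_num)] at h
    obtain ⟨_, rfl, rfl⟩ := h
    left
    rw [Nat.sub_add_cancel (by assumption)]
    exact ⟨hs, h'⟩
  · rw [el_inj (by norm_num) (by norm_num)] at h
    omega
  all_goals exact Or.inr h'

theorem ssucc' {m n : ℕ} {S : ℕ → Set ℕ} {j i e : ℕ}
    (h : (eBB' j i, e) ∈ JsPairs m n S) : e = eBB j i := by
  simp only [JsPairs, Set.mem_union, Set.mem_setOf_eq, Prod.mk.injEq, eBB, eBB', eB, eC,
    Set.mem_singleton_iff] at h ⊢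
  rcases h with ((⟨j', i', _, _, _, _, hs, ⟨h, h'⟩ | ⟨h, h'⟩⟩ | ⟨j', i', _, _, _, _, _, h, h'⟩) | ⟨j', _, _, h, h'⟩) | ⟨h, h'⟩ <;>
    rw [el_inj (by norm_num) (by norm_num)] at h
  · omega
  · obtain ⟨_, rfl, rfl⟩ := h
    exact h'
  all_goals omega

theorem csucc_s {m n : ℕ} {S : ℕ → Set ℕ} {e : ℕ}
    (h : (eC, e) ∈ JsPairs m n S) : e = eC := by
  simp only [JsPairs, Set.mem_union, Set.mem_setOf_eq, Prod.mk.injEq, eBB, eBB', eB, eC,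
    Set.mem_singleton_iff] at h ⊢
  rcases h with ((⟨j', i', _, _, _, _, hs, ⟨h, h'⟩ | ⟨h, h'⟩⟩ | ⟨j', i', _, _, _, _, _, h, h'⟩) | ⟨j', _, _, h, h'⟩) | ⟨h, h'⟩ <;>
    first
    | exact h'
    | exact absurd ((el_inj (by norm_num) (by norm_num)).1 h).1 (by norm_num)

theorem csucc_r {m n : ℕ} {S : ℕ → Set ℕ} {e : ℕ}
    (h : (eC, e) ∈ JrPairs m n S) : e = eC := by
  simp only [JrPairs, JrCore, Set.mem_union, Set.mem_setOf_eq, Prod.mk.injEq, eBB, eBB', eB, eC,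
    Set.mem_singleton_iff] at h ⊢
  rcases h with ⟨j', _, _, h, _⟩ | ((⟨j', i', _, _, _, _, h, h'⟩ | ⟨j', i', _, _, _, _, _, h, _⟩) | ⟨j', _, _, h, _⟩) | ⟨h, h'⟩ <;>
    first
    | exact h'
    | exact absurd ((el_inj (by norm_num) (by norm_num)).1 h).1 (by norm_num)

theorem bsucc {m n : ℕ} {S : ℕ → Set ℕ} {e : ℕ}
    (h : (eB, e) ∈ JrPairs m n S) : ∃ j, 1 ≤ j ∧ j ≤ m ∧ e = eBB j 0 := by
  simp only [JrPairs, JrCore, Set.mem_union, Set.mem_setOf_eq, Prod.mk.injEq, eBB, eBB', eB, eC,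
    Set.mem_singleton_iff] at h ⊢
  rcases h with ⟨j', h1, h2, h, h'⟩ | ((⟨j', i', _, _, _, _, h, h'⟩ | ⟨j', i', _, _, _, _, _, h, _⟩) | ⟨j', _, _, h, _⟩) | ⟨h, h'⟩ <;>
    first
    | exact ⟨j', h1, h2, h'⟩
    | exact absurd ((el_inj (by norm_num) (by norm_num)).1 h).1 (by norm_num)

theorem c_notin (m n : ℕ) (S : ℕ → Set ℕ) (H : Finset ℕ) (i : ℕ) :
    eC ∉ (hsConcept H n i).sem (Jinterp m n S) := by
  induction i with
  | zero =>
    simp only [hsConcept, ALC.sem, Jinterp, if_true, Set.mem_setOf_eq]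
    rintro ⟨j, _, _, h⟩
    unfold eC eBB at h
    rw [el_inj (by norm_num) (by norm_num)] at h
    omega
  | succ i ih =>
    rw [hsConcept]
    split_ifs with hH
    · rintro ⟨e, he, f, hf, hs⟩
      have he : (eC, e) ∈ JsPairs m n S := he
      have hf : (e, f) ∈ JsPairs m n S := hf
      obtain rfl := csucc_s he
      obtain rfl := csucc_s hf
      exact ih hs
    · rintro ⟨e, he, hs⟩
      have he : (eC, e) ∈ JrPairs m n S := he
      obtain rfl := csucc_r he
      exact ih hs

theorem b_path (m n : ℕ) (S : ℕ → Set ℕ) (H : Finset ℕ) (j i : ℕ) (hi : i ≤ n)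
    (h : eBB j (n - i) ∈ (hsConcept H n i).sem (Jinterp m n S)) :
    ∀ x ∈ H, n - i < x → x ≤ n → x ∉ S j := by
  induction i with
  | zero => intros; omega
  | succ i ih =>
    have e1 : n - (i + 1) + 1 = n - i := by omega
    rw [hsConcept] at h
    intro x hx h1 h2
    split_ifs at h with hH
    · obtain ⟨e, he, f, hf, hs⟩ := h
      have he : (_, e) ∈ JsPairs m n S := he
      have hf : (e, f) ∈ JsPairs m n S := hf
      rcases ssucc he with ⟨hn, rfl⟩ | rfl
      · obtain rfl := ssucc' hf
        rw [e1] at hs hn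
        by_cases hx' : x = n - i
        · rw [hx']; exact hn
        · exact ih (by omega) hs x hx (by omega) h2
      · obtain rfl := csucc_s hf
        exact absurd hs (c_notin m n S H i)
    · obtain ⟨e, he, hs⟩ := h
      have he : (_, e) ∈ JrPairs m n S := he
      obtain rfl := rsucc (by omega) he
      rw [e1] at hs
      have hx' : x ≠ n - i := by rintro rfl; exact hH hx
      exact ih (by omega) hs x hx (by omega) h2

theorem a_path (m n : ℕ) (S : ℕ → Set ℕ) (H : Finset ℕ) (i : ℕ) (hi : i ≤ n) :
    eAA (n - i) ∈ (hsConcept H n i).sem (Iinterp m n S) := by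
  induction i with
  | zero => simp [hsConcept, ALC.sem, Iinterp]
  | succ i ih =>
    have e1 : n - (i + 1) = n - i - 1 := by omega
    rw [hsConcept, e1]
    split_ifs with hH
    · refine ⟨eAA' (n - i), ?_, eAA (n - i), ?_, ih (by omega)⟩
      · exact Or.inl (Or.inr ⟨n - i, by omega, by omega, Or.inl rfl⟩)
      · exact Or.inl (Or.inr ⟨n - i, by omega, by omega, Or.inr rfl⟩)
    · refine ⟨eAA (n - i), ?_, ih (by omega)⟩
      exact Or.inl (Or.inl (Or.inr ⟨n - i, by omega, by omega, rfl⟩))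

theorem hs_lang (H : Finset ℕ) (n i : ℕ) : (hsConcept H n i).InLang {Op.ex} := by
  induction i with
  | zero => simp [hsConcept, ALC.InLang]
  | succ i ih => rw [hsConcept]; split_ifs <;> simp [ALC.InLang, ih]

theorem hs_size (H : Finset ℕ) (n i : ℕ) (hi : i ≤ n) :
    (hsConcept H n i).size ≤ 1 + i + (H.filter (fun x => n - i < x)).card := by
  induction i with
  | zero => simp [hsConcept, ALC.size]
  | succ i ih =>
    have ih := ih (by omega)
    rw [hsConcept]
    split_ifs with hH
    · have : (H.filter (fun x => n - i < x)).card < (H.filter (fun x => n - (i + 1) < x)).card := by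
        apply Finset.card_lt_card
        rw [Finset.ssubset_iff_of_subset]
        · exact ⟨n - i, by simp [hH]; omega, by simp⟩
        · intro x; simp only [Finset.mem_filter]; rintro ⟨h, h'⟩; exact ⟨h, by omega⟩
      simp only [ALC.size]; omega
    · have : (H.filter (fun x => n - i < x)).card ≤ (H.filter (fun x => n - (i + 1) < x)).card := by
        apply Finset.card_le_card
        intro x; simp only [Finset.mem_filter]; rintro ⟨h, h'⟩; exact ⟨h, by omega⟩
      simp only [ALC.size]; omega

/-- If {S₁,…,S_m} has a hitting set H with |H| ≤ k, then the L({∃})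
concept ∃r.C_n fits P = {(I,a)}, N = {(J,b)} and has size at most k' = n + k + 2. -/
theorem statement5 (m n k : ℕ) (S : ℕ → Set ℕ)
    (hS : ∀ j, 1 ≤ j → j ≤ m → S j ⊆ Set.Icc 1 n)
    (hcov : ⋃ j ∈ Set.Icc 1 m, S j = Set.Icc 1 n)
    (H : Finset ℕ) (hcard : H.card ≤ k)
    (hhit : ∀ j, 1 ≤ j → j ≤ m → ∃ x ∈ H, x ∈ S j) :
    (ALC.ex 0 (hsConcept H n n)).InLang {Op.ex} ∧
    (ALC.ex 0 (hsConcept H n n)).size ≤ n + k + 2 ∧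
    Fits (ALC.ex 0 (hsConcept H n n)) {(Iinterp m n S, eA)} {(Jinterp m n S, eB)} := by
  refine ⟨⟨rfl, hs_lang H n n⟩, ?_, ?_, ?_⟩
  · have h1 := hs_size H n n le_rfl
    have h2 := Finset.card_filter_le H (fun x => n - n < x)
    simp only [ALC.size]; omega
  · rintro e rfl
    refine ⟨eAA 0, ?_, ?_⟩
    · exact Or.inl (Or.inl (Or.inl (Or.inl (Or.inr rfl))))
    · have := a_path m n S H n le_rfl
      rwa [Nat.sub_self] at this
  · rintro e rfl ⟨f, hf, hs⟩
    have hf : (eB, f) ∈ JrPairs m n S := hf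
    obtain ⟨j, h1, h2, rfl⟩ := bsucc hf
    obtain ⟨x, hx, hxS⟩ := hhit j h1 h2
    have hx' := hS j h1 h2 hxS
    rw [Set.mem_Icc] at hx'
    refine b_path m n S H j n le_rfl ?_ x hx (by omega) hx'.2 hxS
    rw [Nat.sub_self]; exact hs

end ALCPaper
end

section
/- The following are equivalent: (i) the CNF formula φ is satisfiable; (ii) there is an L({∀}) concept that fits P, N; (iii) there is an L({∀,∃,⊓}) concept that fits P, N. -/
open scoped ENNReal

namespace ALCPaper

/-- The interpretation `I_i` built from the DFA `A_i = (Q, step, q₀, Facc)`;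
concept name `F` is 0 and role names `r₀`, `r₁` are 0 and 1. -/
def autInterp (Q : Set ℕ) (step : ℕ → Bool → ℕ) (Facc : Set ℕ) : Interp where
  dom := Q
  cI := fun A => if A = 0 then Facc else ∅
  rI := fun ρ =>
    if ρ = 0 then {p | p.1 ∈ Q ∧ p.2 = step p.1 false}
    else if ρ = 1 then {p | p.1 ∈ Q ∧ p.2 = step p.1 true}
    else ∅

/-- The interpretation `J` with a single element `a = 0`, `F^J = ∅` and
`r₀^J = r₁^J = {(a,a)}`. -/
def loopInterp : Interp where
  dom := {0}
  cI := fun _ => ∅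
  rI := fun ρ => if ρ = 0 ∨ ρ = 1 then {(0, 0)} else ∅

/-- The concept of iterated value restrictions along a word. -/
def wordC : List Bool → ALC
  | [] => .atom 0
  | b :: w => .all (if b then 1 else 0) (wordC w)

theorem wordC_inLang (O : Set Op) (h : Op.all ∈ O) (w : List Bool) : (wordC w).InLang O := by
  induction w with
  | nil => simp [wordC, ALC.InLang]
  | cons b w ih => exact ⟨h, ih⟩

theorem wordC_loop (w : List Bool) : 0 ∉ (wordC w).sem loopInterp := by
  induction w with
  | nil => simp [wordC, ALC.sem, loopInterp]
  | cons b w ih =>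
    intro h
    apply ih
    apply h.2
    cases b <;> simp [loopInterp]

theorem wordC_aut (Q : Set ℕ) (step : ℕ → Bool → ℕ) (Facc : Set ℕ)
    (hstep : ∀ q b, q ∈ Q → step q b ∈ Q) (w : List Bool) :
    ∀ q ∈ Q, w.foldl step q ∈ Facc → q ∈ (wordC w).sem (autInterp Q step Facc) := by
  induction w with
  | nil => intro q _ h; simpa [wordC, ALC.sem, autInterp] using h
  | cons b w ih =>
    intro q hq h
    refine ⟨hq, ?_⟩
    intro e he
    have : e = step q b := by
      cases b <;> simp [autInterp] at he <;> exact he.2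
    subst this
    exact ih _ (hstep _ _ hq) h

theorem exists_word {m : ℕ} (Q : Fin m → Set ℕ) (step : Fin m → ℕ → Bool → ℕ)
    (Facc : Fin m → Set ℕ)
    (hstep : ∀ i q b, q ∈ Q i → step i q b ∈ Q i) (hm : Nonempty (Fin m)) (C : ALC) :
    C.InLang {Op.all, Op.ex, Op.inter} → 0 ∉ C.sem loopInterp →
    ∀ q : Fin m → ℕ, (∀ i, q i ∈ Q i) →
    (∀ i, q i ∈ C.sem (autInterp (Q i) (step i) (Facc i))) →
    ∃ w : List Bool, ∀ i, w.foldl (step i) (q i) ∈ Facc i := by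
  obtain ⟨i0⟩ := hm
  induction C with
  | bot => intro _ _ q _ h; exact absurd (h i0) (by simp [ALC.sem])
  | top => intro _ h; simp [ALC.sem, loopInterp] at h
  | atom A =>
    intro _ _ q _ h
    by_cases hA : A = 0
    · subst hA
      exact ⟨[], fun i => by simpa [ALC.sem, autInterp] using h i⟩
    · exact absurd (h i0) (by simp [ALC.sem, autInterp, hA])
  | neg c _ => intro h; simp [ALC.InLang] at h
  | union c d _ _ => intro h; simp [ALC.InLang] at h
  | inter c d ihc ihd =>
    intro hL h q hq hs
    by_cases hc : 0 ∈ c.sem loopInterp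
    · exact ihd hL.2.2 (fun hd => h ⟨hc, hd⟩) q hq (fun i => (hs i).2)
    · exact ihc hL.2.1 hc q hq (fun i => (hs i).1)
  | all r c ih =>
    intro hL h q hq hs
    have hr : (r = 0 ∨ r = 1) ∧ 0 ∉ c.sem loopInterp := by
      by_contra hcon
      apply h
      refine ⟨by simp [loopInterp], ?_⟩
      intro e he
      by_cases hr : r = 0 ∨ r = 1
      · simp [loopInterp, hr] at he
        subst he
        by_contra hc
        exact hcon ⟨hr, hc⟩
      · simp [loopInterp, hr] at he
    obtain ⟨b, hb⟩ : ∃ b : Bool, r = if b then 1 else 0 := by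
      rcases hr.1 with h | h
      · exact ⟨false, by simpa using h⟩
      · exact ⟨true, by simpa using h⟩
    obtain ⟨w, hw⟩ := ih hL.2 hr.2 (fun i => step i (q i) b) (fun i => hstep _ _ _ (hq i))
      (fun i => (hs i).2 _ (by
        have := hq i
        subst hb; cases b <;> simp [autInterp, this]))
    exact ⟨b :: w, hw⟩
  | ex r c ih =>
    intro hL h q hq hs
    have hr : r = 0 ∨ r = 1 := by
      obtain ⟨e, he, _⟩ := hs i0
      by_contra hcon
      push Not at hcon
      simp [autInterp, hcon.1, hcon.2] at he
    obtain ⟨b, hb⟩ : ∃ b : Bool, r = if b then 1 else 0 := by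
      rcases hr with h | h
      · exact ⟨false, by simpa using h⟩
      · exact ⟨true, by simpa using h⟩
    have hc : 0 ∉ c.sem loopInterp := fun hc => h ⟨0, by simp [loopInterp, hr], hc⟩
    obtain ⟨w, hw⟩ := ih hL.2 hc (fun i => step i (q i) b) (fun i => hstep _ _ _ (hq i))
      (fun i => by
        obtain ⟨e, he, hec⟩ := hs i
        have : e = step i (q i) b := by
          subst hb
          cases b <;> simp [autInterp] at he <;> exact he.2
        exact this ▸ hec)
    exact ⟨b :: w, hw⟩

theorem inLang_mono {O O' : Set Op} (h : O ⊆ O') (C : ALC) : C.InLang O → C.InLang O' := by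
  induction C with
  | bot | top | atom => exact id
  | neg c ih => exact fun hc => ⟨h hc.1, ih hc.2⟩
  | all r c ih => exact fun hc => ⟨h hc.1, ih hc.2⟩
  | ex r c ih => exact fun hc => ⟨h hc.1, ih hc.2⟩
  | inter c d ih ih' => exact fun hc => ⟨h hc.1, ih hc.2.1, ih' hc.2.2⟩
  | union c d ih ih' => exact fun hc => ⟨h hc.1, ih hc.2.1, ih' hc.2.2⟩

/-- the CNF formula φ (with clauses given as sets of literals) is
satisfiable iff there is an L({∀}) concept fitting P, N iff there is an
L({∀,∃,⊓}) concept fitting P, N. -/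
theorem statement9 (nv m : ℕ) (clauses : Fin m → Finset (Fin nv × Bool))
    (Q : Fin m → Set ℕ) (step : Fin m → ℕ → Bool → ℕ)
    (q0 : Fin m → ℕ) (Facc : Fin m → Set ℕ)
    (hQfin : ∀ i, (Q i).Finite) (hq0 : ∀ i, q0 i ∈ Q i) (hFsub : ∀ i, Facc i ⊆ Q i)
    (hstep : ∀ i q b, q ∈ Q i → step i q b ∈ Q i)
    (hlen : ∀ (i : Fin m) (w : List Bool), w.foldl (step i) (q0 i) ∈ Facc i → w.length = nv)
    (hlang : ∀ (i : Fin m) (α : Fin nv → Bool),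
      (List.ofFn α).foldl (step i) (q0 i) ∈ Facc i ↔ ∃ l ∈ clauses i, α l.1 = l.2) :
    ((∃ α : Fin nv → Bool, ∀ i, ∃ l ∈ clauses i, α l.1 = l.2) ↔
      ∃ C : ALC, C.InLang {Op.all} ∧
        Fits C (Set.range fun i : Fin m => ((autInterp (Q i) (step i) (Facc i), q0 i) : Ex))
          {((loopInterp, 0) : Ex)}) ∧
    ((∃ α : Fin nv → Bool, ∀ i, ∃ l ∈ clauses i, α l.1 = l.2) ↔
      ∃ C : ALC, C.InLang {Op.all, Op.ex, Op.inter} ∧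
        Fits C (Set.range fun i : Fin m => ((autInterp (Q i) (step i) (Facc i), q0 i) : Ex))
          {((loopInterp, 0) : Ex)}) := by
  have fwd : (∃ α : Fin nv → Bool, ∀ i, ∃ l ∈ clauses i, α l.1 = l.2) →
      ∃ C : ALC, C.InLang {Op.all} ∧
        Fits C (Set.range fun i : Fin m => ((autInterp (Q i) (step i) (Facc i), q0 i) : Ex))
          {((loopInterp, 0) : Ex)} := by
    rintro ⟨α, hα⟩
    refine ⟨wordC (List.ofFn α), wordC_inLang _ (Set.mem_singleton _) _, ?_, ?_⟩
    · rintro _ ⟨i, rfl⟩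
      exact wordC_aut _ _ _ (hstep i) _ _ (hq0 i) ((hlang i α).2 (hα i))
    · rintro _ rfl
      exact wordC_loop _
  have bwd : (∃ C : ALC, C.InLang {Op.all, Op.ex, Op.inter} ∧
        Fits C (Set.range fun i : Fin m => ((autInterp (Q i) (step i) (Facc i), q0 i) : Ex))
          {((loopInterp, 0) : Ex)}) →
      (∃ α : Fin nv → Bool, ∀ i, ∃ l ∈ clauses i, α l.1 = l.2) := by
    rintro ⟨C, hL, hP, hN⟩
    by_cases hm : Nonempty (Fin m)
    · obtain ⟨w, hw⟩ := exists_word Q step Facc hstep hm C hL (hN _ rfl) q0 hq0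
        (fun i => hP _ ⟨i, rfl⟩)
      obtain ⟨i0⟩ := hm
      have hl := hlen i0 w (hw i0)
      subst hl
      refine ⟨w.get, fun i => (hlang i _).1 ?_⟩
      rw [List.ofFn_get]
      exact hw i
    · exact ⟨fun _ => true, fun i => absurd ⟨i⟩ hm⟩
  have mid : (∃ C : ALC, C.InLang {Op.all} ∧
        Fits C (Set.range fun i : Fin m => ((autInterp (Q i) (step i) (Facc i), q0 i) : Ex))
          {((loopInterp, 0) : Ex)}) → (∃ C : ALC, C.InLang {Op.all, Op.ex, Op.inter} ∧
        Fits C (Set.range fun i : Fin m => ((autInterp (Q i) (step i) (Facc i), q0 i) : Ex))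
          {((loopInterp, 0) : Ex)}) :=
    fun ⟨C, h, h'⟩ => ⟨C, inLang_mono (by simp) C h, h'⟩
  exact ⟨⟨fwd, fun h => bwd (mid h)⟩, ⟨fun h => mid (fwd h), bwd⟩⟩

end ALCPaper
end
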